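/- The map s_ij ↦ s_ij^{(0)} defines an injective algebra homomorphism (an embedding) from the twisted quantized enveloping algebra U^tw_q(o_N) into the twisted q-Yangian Y^tw_q(o_N), where U^tw_q(o_N) is presented by generators s_ij with relations s_ij = 0 for i < j, s_ii = 1 and the reflection equation R S₁ Rᵗ S₂ = S₂ Rᵗ S₁ R, and Y^tw_q(o_N) is presented by generators s_ij^{(r)} with relations s_ij^{(0)} = 0 for i < j, s_ii^{(0)} = 1 and the affine reflection equation R(u,v) S₁(u) Rᵗ(u⁻¹,v) S₂(v) = S₂(v) Rᵗ(u⁻¹,v) S₁(u) R(u,v). -/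

import Mathlib

noncomputable section

open scoped TensorProduct

abbrev FF : Type := RatFunc ℂ

def qq : FF := RatFunc.X

/-! Constant R-matrices acting in `ℂ^N ⊗ ℂ^N`, written as matrices indexed by pairs. -/

def Rc (F : Type) [Field F] (q : F) (N : ℕ) :
    Matrix (Fin N × Fin N) (Fin N × Fin N) F := Matrix.of fun p r =>
  (if p = r then (if p.1 = p.2 then q else 1) else 0)
  + (if p.1 = r.2 ∧ p.2 = r.1 ∧ p.1 < p.2 then q - q⁻¹ else 0)

/-- `R` transposed in the first tensor factor. -/
def Rct (F : Type) [Field F] (q : F) (N : ℕ) :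
    Matrix (Fin N × Fin N) (Fin N × Fin N) F :=
  Matrix.of fun p r => Rc F q N (r.1, p.2) (p.1, r.2)

def Rtil (F : Type) [Field F] (q : F) (N : ℕ) :
    Matrix (Fin N × Fin N) (Fin N × Fin N) F := Matrix.of fun p r =>
  (if p = r then (if p.1 = p.2 then q⁻¹ else 1) else 0)
  + (if p.1 = r.2 ∧ p.2 = r.1 ∧ p.2 < p.1 then q⁻¹ - q else 0)

def Rtilt (F : Type) [Field F] (q : F) (N : ℕ) :
    Matrix (Fin N × Fin N) (Fin N × Fin N) F :=
  Matrix.of fun p r => Rtil F q N (r.1, p.2) (p.1, r.2)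

/-- `S ↦ S ⊗ 1` (action in the first copy of `End ℂ^N`). -/
def amp1 {A : Type} [Ring A] {N : ℕ} (M : Matrix (Fin N) (Fin N) A) :
    Matrix (Fin N × Fin N) (Fin N × Fin N) A :=
  Matrix.of fun p r => if p.2 = r.2 then M p.1 r.1 else 0

/-- `S ↦ 1 ⊗ S` (action in the second copy of `End ℂ^N`). -/
def amp2 {A : Type} [Ring A] {N : ℕ} (M : Matrix (Fin N) (Fin N) A) :
    Matrix (Fin N × Fin N) (Fin N × Fin N) A :=
  Matrix.of fun p r => if p.1 = r.1 then M p.2 r.2 else 0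

/-- A scalar matrix viewed as a matrix over an `F`-algebra `A`. -/
def liftF (F : Type) [Field F] {A : Type} [Ring A] [Algebra F A] {m : Type}
    (M : Matrix m m F) : Matrix m m A := M.map (algebraMap F A)

/-- Left hand side `R S₁ Rᵗ S₂` of the reflection equation. -/
def reflLHS (F : Type) [Field F] (q : F) {N : ℕ} {A : Type} [Ring A] [Algebra F A]
    (S : Matrix (Fin N) (Fin N) A) : Matrix (Fin N × Fin N) (Fin N × Fin N) A :=
  liftF F (Rc F q N) * amp1 S * liftF F (Rct F q N) * amp2 S

/-- Right hand side `S₂ Rᵗ S₁ R` of the reflection equation. -/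
def reflRHS (F : Type) [Field F] (q : F) {N : ℕ} {A : Type} [Ring A] [Algebra F A]
    (S : Matrix (Fin N) (Fin N) A) : Matrix (Fin N × Fin N) (Fin N × Fin N) A :=
  amp2 S * liftF F (Rct F q N) * amp1 S * liftF F (Rc F q N)

/-- The list of index pairs `(i,j)` in lexicographic order. -/
def lexPairs (N : ℕ) : List (Fin N × Fin N) :=
  (List.finRange N).flatMap fun i => (List.finRange N).map fun j => (i, j)

/-! The generic matrix of generators. -/

def Sfree (F : Type) [Field F] (N : ℕ) :
    Matrix (Fin N) (Fin N) (FreeAlgebra F (Fin N × Fin N)) :=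
  Matrix.of fun i j => FreeAlgebra.ι F (i, j)

/-- Defining relations: only the reflection equation. -/
inductive Rel0 (F : Type) [Field F] (q : F) (N : ℕ) :
    FreeAlgebra F (Fin N × Fin N) → FreeAlgebra F (Fin N × Fin N) → Prop
  | refl (p r : Fin N × Fin N) :
      Rel0 F q N (reflLHS F q (Sfree F N) p r) (reflRHS F q (Sfree F N) p r)

/-- The algebra with generators `s_ij` and the reflection equation as defining relations. -/
abbrev Alg0 (F : Type) [Field F] (q : F) (N : ℕ) := RingQuot (Rel0 F q N)

def s0 (F : Type) [Field F] (q : F) (N : ℕ) (i j : Fin N) : Alg0 F q N :=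
  RingQuot.mkAlgHom F (Rel0 F q N) (FreeAlgebra.ι F (i, j))

/-- Defining relations of the presented algebra `𝒮` of the orthogonal case. -/
inductive OSRel (F : Type) [Field F] (q : F) (N : ℕ) :
    FreeAlgebra F (Fin N × Fin N) → FreeAlgebra F (Fin N × Fin N) → Prop
  | tri (i j : Fin N) (h : i < j) : OSRel F q N (FreeAlgebra.ι F (i, j)) 0
  | diag (i : Fin N) : OSRel F q N (FreeAlgebra.ι F (i, i)) 1
  | refl (p r : Fin N × Fin N) :
      OSRel F q N (reflLHS F q (Sfree F N) p r) (reflRHS F q (Sfree F N) p r)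

abbrev AlgOS (F : Type) [Field F] (q : F) (N : ℕ) := RingQuot (OSRel F q N)

def sOS (F : Type) [Field F] (q : F) (N : ℕ) (i j : Fin N) : AlgOS F q N :=
  RingQuot.mkAlgHom F (OSRel F q N) (FreeAlgebra.ι F (i, j))

/-! The quantized enveloping algebra `U_q(gl_N)` by its RTT presentation. -/

abbrev GlGen (N : ℕ) := (Fin N × Fin N) ⊕ (Fin N × Fin N)

def Tfree (F : Type) [Field F] (N : ℕ) :
    Matrix (Fin N) (Fin N) (FreeAlgebra F (GlGen N)) :=
  Matrix.of fun i j => FreeAlgebra.ι F (Sum.inl (i, j))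

def Tbfree (F : Type) [Field F] (N : ℕ) :
    Matrix (Fin N) (Fin N) (FreeAlgebra F (GlGen N)) :=
  Matrix.of fun i j => FreeAlgebra.ι F (Sum.inr (i, j))

/-- `R X₁ Y₂` -/
def rttLHS (F : Type) [Field F] (q : F) {N : ℕ} {A : Type} [Ring A] [Algebra F A]
    (X Y : Matrix (Fin N) (Fin N) A) : Matrix (Fin N × Fin N) (Fin N × Fin N) A :=
  liftF F (Rc F q N) * amp1 X * amp2 Y

/-- `Y₂ X₁ R` -/
def rttRHS (F : Type) [Field F] (q : F) {N : ℕ} {A : Type} [Ring A] [Algebra F A]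
    (X Y : Matrix (Fin N) (Fin N) A) : Matrix (Fin N × Fin N) (Fin N × Fin N) A :=
  amp2 Y * amp1 X * liftF F (Rc F q N)

inductive GlRel (F : Type) [Field F] (q : F) (N : ℕ) :
    FreeAlgebra F (GlGen N) → FreeAlgebra F (GlGen N) → Prop
  | t_zero (i j : Fin N) (h : i < j) : GlRel F q N (Tfree F N i j) 0
  | tb_zero (i j : Fin N) (h : j < i) : GlRel F q N (Tbfree F N i j) 0
  | t_tb (i : Fin N) : GlRel F q N (Tfree F N i i * Tbfree F N i i) 1
  | tb_t (i : Fin N) : GlRel F q N (Tbfree F N i i * Tfree F N i i) 1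
  | rtt (p r : Fin N × Fin N) :
      GlRel F q N (rttLHS F q (Tfree F N) (Tfree F N) p r)
        (rttRHS F q (Tfree F N) (Tfree F N) p r)
  | rtbtb (p r : Fin N × Fin N) :
      GlRel F q N (rttLHS F q (Tbfree F N) (Tbfree F N) p r)
        (rttRHS F q (Tbfree F N) (Tbfree F N) p r)
  | rtbt (p r : Fin N × Fin N) :
      GlRel F q N (rttLHS F q (Tbfree F N) (Tfree F N) p r)
        (rttRHS F q (Tbfree F N) (Tfree F N) p r)

/-- The quantized enveloping algebra `U_q(gl_N)`. -/
abbrev UqGl (F : Type) [Field F] (q : F) (N : ℕ) := RingQuot (GlRel F q N)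

def tE (F : Type) [Field F] (q : F) (N : ℕ) (i j : Fin N) : UqGl F q N :=
  RingQuot.mkAlgHom F (GlRel F q N) (FreeAlgebra.ι F (Sum.inl (i, j)))

def tbE (F : Type) [Field F] (q : F) (N : ℕ) (i j : Fin N) : UqGl F q N :=
  RingQuot.mkAlgHom F (GlRel F q N) (FreeAlgebra.ι F (Sum.inr (i, j)))

/-- The entries `s_ij = Σ_a t_ia t̄_ja` of `S = T T̄ᵗ`. -/
def sE (F : Type) [Field F] (q : F) (N : ℕ) (i j : Fin N) : UqGl F q N :=
  ∑ a : Fin N, tE F q N i a * tbE F q N j a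

/-- The twisted quantized enveloping algebra `U^tw_q(o_N)` as a subalgebra of `U_q(gl_N)`. -/
def UtwO (F : Type) [Field F] (q : F) (N : ℕ) : Subalgebra F (UqGl F q N) :=
  Algebra.adjoin F {x | ∃ i j, x = sE F q N i j}

/-! Symplectic (finite) case. -/

/-- `2k` as an element of `Fin (2n)` (the 0-based version of the odd index `2k-1`). -/
def fe (n : ℕ) (k : Fin n) : Fin (2 * n) := ⟨2 * k.val, by have := k.isLt; omega⟩

/-- `2k+1` as an element of `Fin (2n)` (the 0-based version of the even index `2k`). -/
def fo (n : ℕ) (k : Fin n) : Fin (2 * n) := ⟨2 * k.val + 1, by have := k.isLt; omega⟩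

/-- The entries `s_ij` of `S = T G T̄ᵗ` in `U_q(gl_2n)`. -/
def sSp (F : Type) [Field F] (q : F) (n : ℕ) (i j : Fin (2 * n)) : UqGl F q (2 * n) :=
  algebraMap F _ q * ∑ a : Fin n, tE F q (2 * n) i (fe n a) * tbE F q (2 * n) j (fo n a)
    - ∑ a : Fin n, tE F q (2 * n) i (fo n a) * tbE F q (2 * n) j (fe n a)

abbrev SpGen (n : ℕ) := (Fin (2 * n) × Fin (2 * n)) ⊕ Fin n

def SpFreeS (F : Type) [Field F] (n : ℕ) :
    Matrix (Fin (2 * n)) (Fin (2 * n)) (FreeAlgebra F (SpGen n)) :=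
  Matrix.of fun i j => FreeAlgebra.ι F (Sum.inl (i, j))

/-- Defining relations of the presented algebra `𝒮` of the symplectic case. -/
inductive SpRel (F : Type) [Field F] (q : F) (n : ℕ) :
    FreeAlgebra F (SpGen n) → FreeAlgebra F (SpGen n) → Prop
  | tri (i j : Fin (2 * n)) (h : i < j) (h' : ¬(i.val % 2 = 0 ∧ j.val = i.val + 1)) :
      SpRel F q n (FreeAlgebra.ι F (Sum.inl (i, j))) 0
  | quad (k : Fin n) :
      SpRel F q n
        (FreeAlgebra.ι F (Sum.inl (fo n k, fo n k)) * FreeAlgebra.ι F (Sum.inl (fe n k, fe n k)))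
        (algebraMap F _ (q ^ 2) *
            (FreeAlgebra.ι F (Sum.inl (fo n k, fe n k)) *
              FreeAlgebra.ι F (Sum.inl (fe n k, fo n k)))
          + algebraMap F _ (q ^ 3))
  | invR (k : Fin n) :
      SpRel F q n
        (FreeAlgebra.ι F (Sum.inl (fe n k, fo n k)) * FreeAlgebra.ι F (Sum.inr k)) 1
  | invL (k : Fin n) :
      SpRel F q n
        (FreeAlgebra.ι F (Sum.inr k) * FreeAlgebra.ι F (Sum.inl (fe n k, fo n k))) 1
  | refl (p r : Fin (2 * n) × Fin (2 * n)) :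
      SpRel F q n (reflLHS F q (SpFreeS F n) p r) (reflRHS F q (SpFreeS F n) p r)

abbrev AlgSp (F : Type) [Field F] (q : F) (n : ℕ) := RingQuot (SpRel F q n)

def sSpP (F : Type) [Field F] (q : F) (n : ℕ) (i j : Fin (2 * n)) : AlgSp F q n :=
  RingQuot.mkAlgHom F (SpRel F q n) (FreeAlgebra.ι F (Sum.inl (i, j)))

def sInvP (F : Type) [Field F] (q : F) (n : ℕ) (k : Fin n) : AlgSp F q n :=
  RingQuot.mkAlgHom F (SpRel F q n) (FreeAlgebra.ι F (Sum.inr k))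

/-- row `i = 2k` of the symplectic ordered monomial: positions `(i,0),…,(i,2k)`. -/
def rowA (n : ℕ) (k : Fin n) : List (Fin (2 * n) × Fin (2 * n)) :=
  ((List.finRange (2 * n)).filter fun j => j.val ≤ 2 * k.val).map fun j => (fe n k, j)

/-- row `i' = 2k+1` of the symplectic ordered monomial: positions `(i',0),…,(i',2k-1)`. -/
def rowB (n : ℕ) (k : Fin n) : List (Fin (2 * n) × Fin (2 * n)) :=
  ((List.finRange (2 * n)).filter fun j => j.val + 2 ≤ 2 * k.val + 1).map fun j => (fo n k, j)

/-- The ordered monomials of the symplectic case, with an arbitrary integer exponent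
on each `s_{i i'}` and nonnegative exponents elsewhere. -/
def monomSp {A : Type} [Ring A] (n : ℕ) (s : Fin (2 * n) × Fin (2 * n) → A) (sI : Fin n → A)
    (kN : Fin (2 * n) × Fin (2 * n) → ℕ) (kZ : Fin n → ℤ) : A :=
  ((List.finRange n).map fun k =>
    ((rowA n k).map fun p => s p ^ kN p).prod *
      (if 0 ≤ kZ k then s (fe n k, fo n k) ^ (kZ k).toNat else sI k ^ (-(kZ k)).toNat) *
      s (fo n k, fo n k) ^ kN (fo n k, fo n k) *
      ((rowB n k).map fun p => s p ^ kN p).prod).prod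

/-! Affine (twisted q-Yangian) machinery.  Series are treated coefficientwise. -/

/-- `z1 S r` is the coefficient matrix (in the first copy) of a series indexed by
nonnegative integers, extended by zero to `ℤ`. -/
def z1 {A : Type} [Ring A] {N : ℕ} (S : ℕ → Matrix (Fin N) (Fin N) A) (r : ℤ) :
    Matrix (Fin N × Fin N) (Fin N × Fin N) A :=
  if 0 ≤ r then amp1 (S r.toNat) else 0

def z2 {A : Type} [Ring A] {N : ℕ} (S : ℕ → Matrix (Fin N) (Fin N) A) (r : ℤ) :
    Matrix (Fin N × Fin N) (Fin N × Fin N) A :=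
  if 0 ≤ r then amp2 (S r.toNat) else 0

/-- Coefficient of `u^a v^b` in `R(u,v) S₁(u) Rᵗ(u⁻¹,v) S₂(v)`,
using `R(u,v) = u R̃ - v R` and `Rᵗ(u⁻¹,v) = u⁻¹ R̃ᵗ - v Rᵗ`. -/
def affLHS (F : Type) [Field F] (q : F) {N : ℕ} {A : Type} [Ring A] [Algebra F A]
    (S : ℕ → Matrix (Fin N) (Fin N) A) (a b : ℤ) :
    Matrix (Fin N × Fin N) (Fin N × Fin N) A :=
  liftF F (Rtil F q N) * z1 S (-a) * liftF F (Rtilt F q N) * z2 S (-b)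
    - liftF F (Rtil F q N) * z1 S (1 - a) * liftF F (Rct F q N) * z2 S (1 - b)
    - liftF F (Rc F q N) * z1 S (-1 - a) * liftF F (Rtilt F q N) * z2 S (1 - b)
    + liftF F (Rc F q N) * z1 S (-a) * liftF F (Rct F q N) * z2 S (2 - b)

/-- Coefficient of `u^a v^b` in `S₂(v) Rᵗ(u⁻¹,v) S₁(u) R(u,v)`. -/
def affRHS (F : Type) [Field F] (q : F) {N : ℕ} {A : Type} [Ring A] [Algebra F A]
    (S : ℕ → Matrix (Fin N) (Fin N) A) (a b : ℤ) :
    Matrix (Fin N × Fin N) (Fin N × Fin N) A :=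
  z2 S (-b) * liftF F (Rtilt F q N) * z1 S (-a) * liftF F (Rtil F q N)
    - z2 S (1 - b) * liftF F (Rtilt F q N) * z1 S (-1 - a) * liftF F (Rc F q N)
    - z2 S (1 - b) * liftF F (Rct F q N) * z1 S (1 - a) * liftF F (Rtil F q N)
    + z2 S (2 - b) * liftF F (Rct F q N) * z1 S (-a) * liftF F (Rc F q N)

def SfreeA (F : Type) [Field F] (N : ℕ) (r : ℕ) :
    Matrix (Fin N) (Fin N) (FreeAlgebra F (ℕ × Fin N × Fin N)) :=
  Matrix.of fun i j => FreeAlgebra.ι F (r, i, j)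

/-- Defining relations: only the affine reflection equation (coefficientwise). -/
inductive Rel9 (F : Type) [Field F] (q : F) (N : ℕ) :
    FreeAlgebra F (ℕ × Fin N × Fin N) → FreeAlgebra F (ℕ × Fin N × Fin N) → Prop
  | refl (a b : ℤ) (p r : Fin N × Fin N) :
      Rel9 F q N (affLHS F q (SfreeA F N) a b p r) (affRHS F q (SfreeA F N) a b p r)

abbrev Alg9 (F : Type) [Field F] (q : F) (N : ℕ) := RingQuot (Rel9 F q N)

def s9 (F : Type) [Field F] (q : F) (N : ℕ) (r : ℕ) (i j : Fin N) : Alg9 F q N :=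
  RingQuot.mkAlgHom F (Rel9 F q N) (FreeAlgebra.ι F (r, i, j))

/-- Defining relations of the presented twisted q-Yangian (orthogonal case). -/
inductive AORel (F : Type) [Field F] (q : F) (N : ℕ) :
    FreeAlgebra F (ℕ × Fin N × Fin N) → FreeAlgebra F (ℕ × Fin N × Fin N) → Prop
  | tri (i j : Fin N) (h : i < j) : AORel F q N (FreeAlgebra.ι F (0, i, j)) 0
  | diag (i : Fin N) : AORel F q N (FreeAlgebra.ι F (0, i, i)) 1
  | refl (a b : ℤ) (p r : Fin N × Fin N) :
      AORel F q N (affLHS F q (SfreeA F N) a b p r) (affRHS F q (SfreeA F N) a b p r)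

abbrev AlgAO (F : Type) [Field F] (q : F) (N : ℕ) := RingQuot (AORel F q N)

def sAO (F : Type) [Field F] (q : F) (N : ℕ) (r : ℕ) (i j : Fin N) : AlgAO F q N :=
  RingQuot.mkAlgHom F (AORel F q N) (FreeAlgebra.ι F (r, i, j))

/-- Lexicographic (non-strict) comparison of triples. -/
def tripLe (x y : ℕ × ℕ × ℕ) : Prop :=
  x.1 < y.1 ∨ (x.1 = y.1 ∧ (x.2.1 < y.2.1 ∨ (x.2.1 = y.2.1 ∧ x.2.2 ≤ y.2.2)))

/-- A list of generator indices `(r,i,j)` is ordered if it is weakly increasing with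
respect to the lexicographic order on `(r,i,j)`. -/
def sortedGens {N : ℕ} (l : List (ℕ × Fin N × Fin N)) : Prop :=
  l.Chain' fun x y => tripLe (x.1, x.2.1.val, x.2.2.val) (y.1, y.2.1.val, y.2.2.val)

/-! The quantum affine algebra `U_q(ĝl_N)` by its RTT presentation, coefficientwise. -/

abbrev AffGen (N : ℕ) := (ℕ × Fin N × Fin N) ⊕ (ℕ × Fin N × Fin N)

def TfA (F : Type) [Field F] (N : ℕ) (r : ℕ) :
    Matrix (Fin N) (Fin N) (FreeAlgebra F (AffGen N)) :=
  Matrix.of fun i j => FreeAlgebra.ι F (Sum.inl (r, i, j))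

def TbfA (F : Type) [Field F] (N : ℕ) (r : ℕ) :
    Matrix (Fin N) (Fin N) (FreeAlgebra F (AffGen N)) :=
  Matrix.of fun i j => FreeAlgebra.ι F (Sum.inr (r, i, j))

/-- Coefficient of `u^a v^b` in `R(u,v) X₁ Y₂` with prescribed coefficient extractions. -/
def affRttL (F : Type) [Field F] (q : F) {N : ℕ} {A : Type} [Ring A] [Algebra F A]
    (X Y : ℕ → Matrix (Fin N) (Fin N) A) (a b a' b' : ℤ) :
    Matrix (Fin N × Fin N) (Fin N × Fin N) A :=
  liftF F (Rtil F q N) * z1 X a * z2 Y b - liftF F (Rc F q N) * z1 X a' * z2 Y b'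

def affRttR (F : Type) [Field F] (q : F) {N : ℕ} {A : Type} [Ring A] [Algebra F A]
    (X Y : ℕ → Matrix (Fin N) (Fin N) A) (a b a' b' : ℤ) :
    Matrix (Fin N × Fin N) (Fin N × Fin N) A :=
  z2 Y b * z1 X a * liftF F (Rtil F q N) - z2 Y b' * z1 X a' * liftF F (Rc F q N)

inductive AffGlRel (F : Type) [Field F] (q : F) (N : ℕ) :
    FreeAlgebra F (AffGen N) → FreeAlgebra F (AffGen N) → Prop
  | t0_tri (i j : Fin N) (h : i < j) : AffGlRel F q N (TfA F N 0 i j) 0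
  | tb0_tri (i j : Fin N) (h : j < i) : AffGlRel F q N (TbfA F N 0 i j) 0
  | t_tb (i : Fin N) : AffGlRel F q N (TfA F N 0 i i * TbfA F N 0 i i) 1
  | tb_t (i : Fin N) : AffGlRel F q N (TbfA F N 0 i i * TfA F N 0 i i) 1
  | rtt (a b : ℤ) (p r : Fin N × Fin N) :
      AffGlRel F q N
        (affRttL F q (TfA F N) (TfA F N) (1 - a) (-b) (-a) (1 - b) p r)
        (affRttR F q (TfA F N) (TfA F N) (1 - a) (-b) (-a) (1 - b) p r)
  | rtbtb (a b : ℤ) (p r : Fin N × Fin N) :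
      AffGlRel F q N
        (affRttL F q (TbfA F N) (TbfA F N) (a - 1) b a (b - 1) p r)
        (affRttR F q (TbfA F N) (TbfA F N) (a - 1) b a (b - 1) p r)
  | rtbt (a b : ℤ) (p r : Fin N × Fin N) :
      AffGlRel F q N
        (affRttL F q (TbfA F N) (TfA F N) (a - 1) (-b) a (1 - b) p r)
        (affRttR F q (TbfA F N) (TfA F N) (a - 1) (-b) a (1 - b) p r)

/-- The quantum affine algebra `U_q(ĝl_N)`. -/
abbrev UqAff (F : Type) [Field F] (q : F) (N : ℕ) := RingQuot (AffGlRel F q N)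

def tA (F : Type) [Field F] (q : F) (N : ℕ) (r : ℕ) (i j : Fin N) : UqAff F q N :=
  RingQuot.mkAlgHom F (AffGlRel F q N) (FreeAlgebra.ι F (Sum.inl (r, i, j)))

def tbA (F : Type) [Field F] (q : F) (N : ℕ) (r : ℕ) (i j : Fin N) : UqAff F q N :=
  RingQuot.mkAlgHom F (AffGlRel F q N) (FreeAlgebra.ι F (Sum.inr (r, i, j)))

/-- Coefficient of `u^{-r}` in `s_ij(u) = Σ_a t_ia(u) t̄_ja(u⁻¹)`. -/
def Scoef (F : Type) [Field F] (q : F) (N : ℕ) (r : ℕ) (i j : Fin N) : UqAff F q N :=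
  ∑ a : Fin N, ∑ p ∈ Finset.range (r + 1), tA F q N p i a * tbA F q N (r - p) j a

/-- The twisted q-Yangian `Y^tw_q(o_N)` as a subalgebra of `U_q(ĝl_N)`. -/
def YtwO (F : Type) [Field F] (q : F) (N : ℕ) : Subalgebra F (UqAff F q N) :=
  Algebra.adjoin F {x | ∃ r i j, x = Scoef F q N r i j}

/-- Coefficient of `u^{-r}` in `s_ij(u)`, the `(i,j)` entry of `S(u) = T(u) G T̄(u⁻¹)ᵗ`
in the symplectic case. -/
def ScoefSp (F : Type) [Field F] (q : F) (n : ℕ) (r : ℕ) (i j : Fin (2 * n)) :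
    UqAff F q (2 * n) :=
  ∑ a : Fin n, ∑ p ∈ Finset.range (r + 1),
    (algebraMap F _ q * (tA F q (2 * n) p i (fe n a) * tbA F q (2 * n) (r - p) j (fo n a))
      - tA F q (2 * n) p i (fo n a) * tbA F q (2 * n) (r - p) j (fe n a))

/-- The twisted q-Yangian `Y^tw_q(sp_2n)` as a subalgebra of `U_q(ĝl_2n)`,
with a prescribed family of inverses of `s^{(0)}_{ii'}`. -/
def YtwSp (F : Type) [Field F] (q : F) (n : ℕ) (inv : Fin n → UqAff F q (2 * n)) :
    Subalgebra F (UqAff F q (2 * n)) :=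
  Algebra.adjoin F ({x | ∃ r i j, x = ScoefSp F q n r i j} ∪ Set.range inv)

abbrev ASpGen (n : ℕ) := (ℕ × Fin (2 * n) × Fin (2 * n)) ⊕ Fin n

def SfreeASp (F : Type) [Field F] (n : ℕ) (r : ℕ) :
    Matrix (Fin (2 * n)) (Fin (2 * n)) (FreeAlgebra F (ASpGen n)) :=
  Matrix.of fun i j => FreeAlgebra.ι F (Sum.inl (r, i, j))

/-- Defining relations of the presented twisted q-Yangian (symplectic case). -/
inductive ASpRel (F : Type) [Field F] (q : F) (n : ℕ) :
    FreeAlgebra F (ASpGen n) → FreeAlgebra F (ASpGen n) → Prop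
  | tri (i j : Fin (2 * n)) (h : i < j) (h' : ¬(i.val % 2 = 0 ∧ j.val = i.val + 1)) :
      ASpRel F q n (FreeAlgebra.ι F (Sum.inl (0, i, j))) 0
  | quad (k : Fin n) :
      ASpRel F q n
        (FreeAlgebra.ι F (Sum.inl (0, fo n k, fo n k)) *
          FreeAlgebra.ι F (Sum.inl (0, fe n k, fe n k)))
        (algebraMap F _ (q ^ 2) *
            (FreeAlgebra.ι F (Sum.inl (0, fo n k, fe n k)) *
              FreeAlgebra.ι F (Sum.inl (0, fe n k, fo n k)))
          + algebraMap F _ (q ^ 3))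
  | invR (k : Fin n) :
      ASpRel F q n
        (FreeAlgebra.ι F (Sum.inl (0, fe n k, fo n k)) * FreeAlgebra.ι F (Sum.inr k)) 1
  | invL (k : Fin n) :
      ASpRel F q n
        (FreeAlgebra.ι F (Sum.inr k) * FreeAlgebra.ι F (Sum.inl (0, fe n k, fo n k))) 1
  | refl (a b : ℤ) (p r : Fin (2 * n) × Fin (2 * n)) :
      ASpRel F q n (affLHS F q (SfreeASp F n) a b p r) (affRHS F q (SfreeASp F n) a b p r)

abbrev AlgASp (F : Type) [Field F] (q : F) (n : ℕ) := RingQuot (ASpRel F q n)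

def sASp (F : Type) [Field F] (q : F) (n : ℕ) (r : ℕ) (i j : Fin (2 * n)) : AlgASp F q n :=
  RingQuot.mkAlgHom F (ASpRel F q n) (FreeAlgebra.ι F (Sum.inl (r, i, j)))

def sInvASp (F : Type) [Field F] (q : F) (n : ℕ) (k : Fin n) : AlgASp F q n :=
  RingQuot.mkAlgHom F (ASpRel F q n) (FreeAlgebra.ι F (Sum.inr k))

/-! q-antisymmetrizer and Sklyanin/quantum determinant machinery. -/

/-- The trigonometric R-matrix `R(u,v)`. -/
def Rtrig (F : Type) [Field F] (q : F) (N : ℕ) (u v : F) :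
    Matrix (Fin N × Fin N) (Fin N × Fin N) F := Matrix.of fun p r =>
  (if p = r then (if p.1 = p.2 then q⁻¹ * u - q * v else u - v) else 0)
  + (if p.1 = r.2 ∧ p.2 = r.1 ∧ p.1 ≠ p.2 then
      (q⁻¹ - q) * (if p.2 < p.1 then u else v) else 0)

/-- An operator on `ℂ^N ⊗ ℂ^N` acting in the `i`-th and `j`-th factors of `(ℂ^N)^{⊗ r}`. -/
def big2 (F : Type) [Field F] {N r : ℕ} (i j : Fin r)
    (M : Matrix (Fin N × Fin N) (Fin N × Fin N) F) :
    Matrix (Fin r → Fin N) (Fin r → Fin N) F :=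
  Matrix.of fun f g =>
    if ∀ k, k ≠ i → k ≠ j → f k = g k then M (f i, f j) (g i, g j) else 0

/-- The list of the pairs `(i,j)`, `i < j`, in lexicographic order. -/
def pairsLex (r : ℕ) : List (Fin r × Fin r) :=
  (List.finRange r).flatMap fun i =>
    ((List.finRange r).filter fun j => i < j).map fun j => (i, j)

/-- The number of inversions (the Coxeter length) of a permutation. -/
def invCount {r : ℕ} (σ : Equiv.Perm (Fin r)) : ℕ :=
  (Finset.univ.filter fun p : Fin r × Fin r => p.1 < p.2 ∧ σ p.2 < σ p.1).card

/-- The q-permutation operator `P^q` on `ℂ^N ⊗ ℂ^N`. -/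
def PqSmall (F : Type) [Field F] (q : F) (N : ℕ) :
    Matrix (Fin N × Fin N) (Fin N × Fin N) F := Matrix.of fun p r =>
  if r.1 = p.2 ∧ r.2 = p.1 then (if p.1 = p.2 then 1 else if p.2 < p.1 then q else q⁻¹)
  else 0

/-- The hypothesis that `Pq` is the extension of the q-permutation operators along
reduced decompositions: `P^q_{σ s_i} = P^q_σ P^q_{s_i}` whenever the length grows. -/
def PqExt (F : Type) [Field F] (q : F) (N r : ℕ)
    (Pq : Equiv.Perm (Fin r) → Matrix (Fin r → Fin N) (Fin r → Fin N) F) : Prop :=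
  Pq 1 = 1 ∧
    ∀ (σ : Equiv.Perm (Fin r)) (i : ℕ) (h : i + 1 < r),
      invCount (σ * Equiv.swap ⟨i, Nat.lt_of_succ_lt h⟩ ⟨i + 1, h⟩) = invCount σ + 1 →
        Pq (σ * Equiv.swap ⟨i, Nat.lt_of_succ_lt h⟩ ⟨i + 1, h⟩) =
          Pq σ * big2 F ⟨i, Nat.lt_of_succ_lt h⟩ ⟨i + 1, h⟩ (PqSmall F q N)

/-- The q-antisymmetrizer `A^q_r = Σ_σ sgn(σ) P^q_σ`. -/
def AqM (F : Type) [Field F] {N r : ℕ}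
    (Pq : Equiv.Perm (Fin r) → Matrix (Fin r → Fin N) (Fin r → Fin N) F) :
    Matrix (Fin r → Fin N) (Fin r → Fin N) F :=
  ∑ σ : Equiv.Perm (Fin r), ((Equiv.Perm.sign σ : ℤ) : F) • Pq σ

/-- A matrix acting in the `k`-th factor of `(ℂ^N)^{⊗ N}`, with entries in `A`. -/
def ampAt {A : Type} [Ring A] {N : ℕ} (k : Fin N) (M : Matrix (Fin N) (Fin N) A) :
    Matrix (Fin N → Fin N) (Fin N → Fin N) A :=
  Matrix.of fun f g => if ∀ l, l ≠ k → f l = g l then M (f k) (g k) else 0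

/-- A scalar two-site operator viewed over `A`, acting at sites `i`, `j`. -/
def big2A (F : Type) [Field F] {A : Type} [Ring A] [Algebra F A] {N : ℕ} (i j : Fin N)
    (M : Matrix (Fin N × Fin N) (Fin N × Fin N) F) :
    Matrix (Fin N → Fin N) (Fin N → Fin N) A :=
  (big2 F i j M).map (algebraMap F A)

/-- Coefficient of `u^m` in a product of formal series, each of which is supported in
degrees `≤ 1`; the series are given by their coefficient functions `ℤ → M`. -/
def seriesProdCoeff {M : Type} [Ring M] : List (ℤ → M) → ℤ → M
  | [], m => if m = 0 then 1 else 0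
  | c :: t, m => ∑ k ∈ Finset.Icc (m - t.length) 1, c k * seriesProdCoeff t (m - k)

/-! Series factors entering the Sklyanin determinant. -/

/-- The matrix `S^{(r)}` of the coefficients of `S(u)` (orthogonal case). -/
def SmatA (F : Type) [Field F] (q : F) (N : ℕ) (r : ℕ) :
    Matrix (Fin N) (Fin N) (UqAff F q N) :=
  Matrix.of fun i j => Scoef F q N r i j

/-- The series `S_k(q^{-2k+2} u)` acting at site `k` (0-based `k`), coefficientwise. -/
def SfacO (F : Type) [Field F] (q : F) (N : ℕ) (k : Fin N) (m : ℤ) :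
    Matrix (Fin N → Fin N) (Fin N → Fin N) (UqAff F q N) :=
  if m ≤ 0 then q ^ (2 * (k.val : ℤ) * (-m)) • ampAt k (SmatA F q N (-m).toNat) else 0

/-- The series `R_{ij}ᵗ((q^{-2i+2}u)⁻¹, q^{-2j+2}u)` (0-based `i`, `j`), coefficientwise. -/
def RtfacO (F : Type) [Field F] (q : F) (N : ℕ) (i j : Fin N) (m : ℤ) :
    Matrix (Fin N → Fin N) (Fin N → Fin N) (UqAff F q N) :=
  if m = -1 then q ^ (2 * (i.val : ℤ)) • big2A F i j (Rtilt F q N)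
  else if m = 1 then (-(q ^ (-2 * (j.val : ℤ)))) • big2A F i j (Rct F q N)
  else 0

/-- The ordered list of factors `S₁(u) R₁₂ᵗ ⋯ R₁Nᵗ S₂(q⁻²u) ⋯ S_N(q^{-2N+2}u)`. -/
def sdetFacsO (F : Type) [Field F] (q : F) (N : ℕ) :
    List (ℤ → Matrix (Fin N → Fin N) (Fin N → Fin N) (UqAff F q N)) :=
  (List.finRange N).flatMap fun i =>
    SfacO F q N i :: (((List.finRange N).filter fun j => i < j).map fun j => RtfacO F q N i j)

/-- The matrix `S^{(r)}` of the coefficients of `S(u)` (symplectic case). -/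
def SmatASp (F : Type) [Field F] (q : F) (n : ℕ) (r : ℕ) :
    Matrix (Fin (2 * n)) (Fin (2 * n)) (UqAff F q (2 * n)) :=
  Matrix.of fun i j => ScoefSp F q n r i j

def SfacSp (F : Type) [Field F] (q : F) (n : ℕ) (k : Fin (2 * n)) (m : ℤ) :
    Matrix (Fin (2 * n) → Fin (2 * n)) (Fin (2 * n) → Fin (2 * n)) (UqAff F q (2 * n)) :=
  if m ≤ 0 then q ^ (2 * (k.val : ℤ) * (-m)) • ampAt k (SmatASp F q n (-m).toNat) else 0

def sdetFacsSp (F : Type) [Field F] (q : F) (n : ℕ) :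
    List (ℤ → Matrix (Fin (2 * n) → Fin (2 * n)) (Fin (2 * n) → Fin (2 * n))
      (UqAff F q (2 * n))) :=
  (List.finRange (2 * n)).flatMap fun i =>
    SfacSp F q n i ::
      (((List.finRange (2 * n)).filter fun j => i < j).map fun j => RtfacO F q (2 * n) i j)

/-- Coefficientwise quantum determinant `qdet T(u)`:
the coefficient of `u^m` (nonzero only for `m ≤ 0`). -/
def qdetTc (F : Type) [Field F] (q : F) (N : ℕ) (m : ℤ) : UqAff F q N :=
  if m ≤ 0 then
    ∑ σ : Equiv.Perm (Fin N), ∑ rv ∈ Finset.Nat.antidiagonalTuple N (-m).toNat,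
      (((-q)⁻¹ ^ invCount σ) * ∏ k : Fin N, q ^ (2 * (k.val : ℤ) * (rv k : ℤ))) •
        ((List.finRange N).map fun k => tA F q N (rv k) (σ k) k).prod
  else 0

/-- Coefficientwise quantum determinant `qdet T̄(q^{2N-2} u⁻¹)`:
the coefficient of `u^m` (nonzero only for `m ≤ 0`). -/
def qdetTbc (F : Type) [Field F] (q : F) (N : ℕ) (m : ℤ) : UqAff F q N :=
  if m ≤ 0 then
    ∑ σ : Equiv.Perm (Fin N), ∑ rv ∈ Finset.Nat.antidiagonalTuple N (-m).toNat,
      (((-q)⁻¹ ^ invCount σ) *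
          ∏ k : Fin N, q ^ ((2 * (N : ℤ) - 2 - 2 * (k.val : ℤ)) * (rv k : ℤ))) •
        ((List.finRange N).map fun k => tbA F q N (rv k) (σ k) k).prod
  else 0

/-- The linear factor `q^{2i-2}u⁻¹ - q^{-2j+2}u` of `γ_N(u)` (0-based `i`, `j`),
viewed as an `A`-valued series. -/
def gamFac (F : Type) [Field F] (q : F) (N : ℕ) (p : Fin N × Fin N) (m : ℤ) : UqAff F q N :=
  if m = -1 then algebraMap F _ (q ^ (2 * (p.1.val : ℤ)))
  else if m = 1 then algebraMap F _ (-(q ^ (-2 * (p.2.val : ℤ)))) else 0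

/-- The list of series whose product is `γ_N(u) qdet T(u) qdet T̄(q^{2N-2}u⁻¹)`
in the orthogonal case. -/
def rhsO (F : Type) [Field F] (q : F) (N : ℕ) : List (ℤ → UqAff F q N) :=
  ((pairsLex N).map fun p => gamFac F q N p) ++ [qdetTc F q N, qdetTbc F q N]

section ReflectionBraid

variable {F : Type} [Field F] {N : ℕ} {A : Type} [Ring A] [Algebra F A]

/-- The matrix `Σ α_ij E_ii ⊗ E_jj + Σ β_ij E_ij ⊗ E_ji`. -/
def permMat (α β : Fin N → Fin N → F) : Matrix (Fin N × Fin N) (Fin N × Fin N) F :=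
  Matrix.of fun p r => (if p = r then α p.1 p.2 else 0)
    + (if p.1 = r.2 ∧ p.2 = r.1 then β p.1 p.2 else 0)

/-- The transpose of `permMat α β` in the first tensor factor. -/
def permMatT (α β : Fin N → Fin N → F) : Matrix (Fin N × Fin N) (Fin N × Fin N) F :=
  Matrix.of fun p r => permMat α β (r.1, p.2) (p.1, r.2)

/-- The action on two-index tensors of the flip composed with `permMat α β`. -/
def braid2 {M : Type} [AddCommGroup M] [Module F M] (α β : Fin N → Fin N → F) :
    Module.End F (Fin N → Fin N → M) where
  toFun f a b := α b a • f b a + β b a • f a b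
  map_add' f g := by ext a b; simp only [Pi.add_apply]; module
  map_smul' c f := by ext a b; simp only [Pi.smul_apply, RingHom.id_apply]; module

/-- Four-index tensors with entries in `A`. -/
abbrev Tensor4 (N : ℕ) (A : Type) : Type := Fin N → Fin N → Fin N → Fin N → A

/-- `braid2` acting on the first two indices. -/
def braidFst (α β : Fin N → Fin N → F) : Module.End F (Tensor4 N A) := braid2 α β

/-- `braid2` acting on the two middle indices. -/
def braidMid (α β : Fin N → Fin N → F) : Module.End F (Tensor4 N A) :=
  LinearMap.compLeft (braid2 α β) (Fin N)

/-- `braid2` acting on the last two indices. -/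
def braidLst (α β : Fin N → Fin N → F) : Module.End F (Tensor4 N A) :=
  LinearMap.compLeft (LinearMap.compLeft (braid2 α β) (Fin N)) (Fin N)

lemma braid2_apply {M : Type} [AddCommGroup M] [Module F M] (α β : Fin N → Fin N → F)
    (f : Fin N → Fin N → M) (a b : Fin N) :
    braid2 α β f a b = α b a • f b a + β b a • f a b := rfl

lemma braidFst_apply (α β : Fin N → Fin N → F) (f : Tensor4 N A) (a b c d : Fin N) :
    braidFst α β f a b c d = α b a • f b a c d + β b a • f a b c d := rfl

lemma braidMid_apply (α β : Fin N → Fin N → F) (f : Tensor4 N A) (a b c d : Fin N) :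
    braidMid α β f a b c d = α c b • f a c b d + β c b • f a b c d := rfl

lemma braidLst_apply (α β : Fin N → Fin N → F) (f : Tensor4 N A) (a b c d : Fin N) :
    braidLst α β f a b c d = α d c • f a b d c + β d c • f a b c d := rfl

/-- The tensor with entries `S_ab T_cd`. -/
def tensorMul (S T : Matrix (Fin N) (Fin N) A) : Tensor4 N A := fun a b c d => S a b * T c d

lemma permMat_mul_apply (α β : Fin N → Fin N → F)
    (M : Matrix (Fin N × Fin N) (Fin N × Fin N) A) (i j : Fin N) (r : Fin N × Fin N) :
    (liftF F (permMat α β) * M : Matrix (Fin N × Fin N) (Fin N × Fin N) A)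
      (i, j) r = α i j • M (i, j) r + β i j • M (j, i) r := by
  simp only [Matrix.mul_apply, liftF, permMat, Matrix.map_apply, Matrix.of_apply, map_add, add_mul,
    Finset.sum_add_distrib, Algebra.smul_def]
  congr 1
  · simp [apply_ite, ite_mul]
  · rw [Finset.sum_eq_single (j, i)]
    · simp
    · rintro ⟨a, b⟩ - h
      rw [if_neg, map_zero, zero_mul]
      rintro ⟨rfl, rfl⟩
      exact h rfl
    · simp

lemma mul_permMat_apply (α β : Fin N → Fin N → F)
    (M : Matrix (Fin N × Fin N) (Fin N × Fin N) A) (p : Fin N × Fin N) (k l : Fin N) :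
    (M * liftF F (permMat α β) : Matrix (Fin N × Fin N) (Fin N × Fin N) A) p (k, l)
      = α k l • M p (k, l) + β l k • M p (l, k) := by
  simp only [Matrix.mul_apply, liftF, permMat, Matrix.map_apply, Matrix.of_apply, map_add, mul_add,
    Finset.sum_add_distrib, Algebra.smul_def, Algebra.commutes]
  congr 1
  · simp [apply_ite]
  · rw [Finset.sum_eq_single (l, k)]
    · simp
    · rintro ⟨a, b⟩ - h
      rw [if_neg, map_zero, mul_zero]
      rintro ⟨rfl, rfl⟩
      exact h rfl
    · simp

lemma amp1_mul_permMatT_mul_amp2_apply (α β : Fin N → Fin N → F)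
    (S T : Matrix (Fin N) (Fin N) A) (i j k l : Fin N) :
    (amp1 S * (liftF F (permMatT α β) * amp2 T) : Matrix (Fin N × Fin N) (Fin N × Fin N) A)
      (i, j) (k, l)
      = braidMid α β (tensorMul S T) i j k l := by
  have h : ∀ c b : Fin N,
      (liftF F (permMatT α β) * amp2 T : Matrix (Fin N × Fin N) (Fin N × Fin N) A) (c, b) (k, l)
      = (if k = c then α k b • T b l else 0) + (if b = c then β k b • T k l else 0) := by
    intro c b
    simp [Matrix.mul_apply, liftF, permMatT, permMat, amp2, Fintype.sum_prod_type, add_mul,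
      Finset.sum_add_distrib, apply_ite (algebraMap F A), ite_and, ← Algebra.smul_def]
  rw [Matrix.mul_apply, Fintype.sum_prod_type]
  simp only [h]
  simp [amp1, braidMid_apply, tensorMul, mul_add, Finset.sum_add_distrib]

lemma amp2_mul_permMatT_mul_amp1_apply (α β : Fin N → Fin N → F) (hα : ∀ a b, α a b = α b a)
    (S T : Matrix (Fin N) (Fin N) A) (i j k l : Fin N) :
    (amp2 T * liftF F (permMatT α β) * amp1 S : Matrix (Fin N × Fin N) (Fin N × Fin N) A)
      (i, j) (k, l)
      = braidMid α β (tensorMul T S) j i l k := by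
  have h : ∀ c d : Fin N,
      (amp2 T * liftF F (permMatT α β) : Matrix (Fin N × Fin N) (Fin N × Fin N) A) (i, j) (c, d)
      = (if i = c then α c d • T j d else 0) + (if c = d then β c i • T j i else 0) := by
    intro c d
    simp [Matrix.mul_apply, liftF, permMatT, permMat, amp2, Fintype.sum_prod_type, mul_add,
      Finset.sum_add_distrib, apply_ite (algebraMap F A), ite_and, ← Algebra.smul_def,
      ← Algebra.commutes]
  rw [Matrix.mul_apply, Fintype.sum_prod_type]
  simp only [h]
  simp [amp1, braidMid_apply, tensorMul, add_mul, Finset.sum_add_distrib, hα l i]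

lemma reflection_left_apply (α β α' β' : Fin N → Fin N → F) (S T : Matrix (Fin N) (Fin N) A)
    (i j k l : Fin N) :
    (liftF F (permMat α β) * amp1 S * liftF F (permMatT α' β') * amp2 T :
        Matrix (Fin N × Fin N) (Fin N × Fin N) A) (i, j) (k, l)
      = (braidFst α β * braidMid α' β' : Module.End F (Tensor4 N A)) (tensorMul S T) j i k l := by
  rw [mul_assoc, mul_assoc, permMat_mul_apply, Module.End.mul_apply, braidFst_apply,
    amp1_mul_permMatT_mul_amp2_apply, amp1_mul_permMatT_mul_amp2_apply]

lemma reflection_right_apply (α β α' β' : Fin N → Fin N → F) (hα : ∀ a b, α a b = α b a)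
    (hα' : ∀ a b, α' a b = α' b a) (S T : Matrix (Fin N) (Fin N) A) (i j k l : Fin N) :
    (amp2 T * liftF F (permMatT α' β') * amp1 S * liftF F (permMat α β) :
        Matrix (Fin N × Fin N) (Fin N × Fin N) A) (i, j) (k, l)
      = (braidLst α β * braidMid α' β' : Module.End F (Tensor4 N A)) (tensorMul T S) j i k l := by
  rw [mul_permMat_apply, Module.End.mul_apply, braidLst_apply, hα k l,
    amp2_mul_permMatT_mul_amp1_apply _ _ hα', amp2_mul_permMatT_mul_amp1_apply _ _ hα']

end ReflectionBraid

section Hecke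

variable (F : Type) [Field F] (q : F) (N : ℕ)

/-- The diagonal coefficients of `R` (and, at `q⁻¹`, of its inverse braiding). -/
def diagCoeff (i j : Fin N) : F := if i = j then q else 1

/-- The off-diagonal coefficients of `R`. -/
def offCoeff (i j : Fin N) : F := if i < j then q - q⁻¹ else 0

/-- The off-diagonal coefficients of `R̃`. -/
def offCoeffInv (i j : Fin N) : F := if j < i then q⁻¹ - q else 0

variable {N}

lemma diagCoeff_comm (a b : Fin N) : diagCoeff F q N a b = diagCoeff F q N b a := by
  simp [diagCoeff, eq_comm]

variable (N)

lemma Rc_eq_permMat : Rc F q N = permMat (diagCoeff F q N) (offCoeff F q N) := by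
  ext p r
  simp only [Rc, permMat, diagCoeff, offCoeff, Matrix.of_apply, ← ite_and, and_assoc]

lemma Rtil_eq_permMat : Rtil F q N = permMat (diagCoeff F q⁻¹ N) (offCoeffInv F q N) := by
  ext p r
  simp only [Rtil, permMat, diagCoeff, offCoeffInv, Matrix.of_apply, ← ite_and, and_assoc]

lemma Rct_eq_permMatT : Rct F q N = permMatT (diagCoeff F q N) (offCoeff F q N) := by
  rw [Rct, Rc_eq_permMat, permMatT]

lemma Rtilt_eq_permMatT : Rtilt F q N = permMatT (diagCoeff F q⁻¹ N) (offCoeffInv F q N) := by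
  rw [Rtilt, Rtil_eq_permMat, permMatT]

/-- The Hecke braiding `P R`. -/
def heckeGen (M : Type) [AddCommGroup M] [Module F M] : Module.End F (Fin N → Fin N → M) :=
  braid2 (diagCoeff F q N) (offCoeff F q N)

/-- The inverse Hecke braiding `P R̃`. -/
def heckeInv (M : Type) [AddCommGroup M] [Module F M] : Module.End F (Fin N → Fin N → M) :=
  braid2 (diagCoeff F q⁻¹ N) (offCoeffInv F q N)

variable {F q N}

lemma heckeGen_eq (M : Type) [AddCommGroup M] [Module F M] :
    heckeGen F q N M = heckeInv F q N M + (q - q⁻¹) • 1 := by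
  refine LinearMap.ext fun f => funext fun a => funext fun b => ?_
  simp only [heckeGen, heckeInv, LinearMap.add_apply, LinearMap.smul_apply, Pi.add_apply,
    Pi.smul_apply, Module.End.one_apply, braid2_apply, diagCoeff, offCoeff, offCoeffInv]
  rcases lt_trichotomy a b with h | rfl | h
  · simp only [h.ne', h, h.not_gt, if_true, if_false]; module
  · simp only [lt_irrefl, if_true, if_false]; module
  · simp only [h.ne, h, h.not_gt, if_true, if_false]; module

lemma heckeGen_mul_heckeInv (hq : q ≠ 0) (M : Type) [AddCommGroup M] [Module F M] :
    heckeGen F q N M * heckeInv F q N M = 1 := by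
  refine LinearMap.ext fun f => funext fun a => funext fun b => ?_
  simp only [heckeGen, heckeInv, Module.End.mul_apply, Module.End.one_apply, braid2_apply,
    diagCoeff, offCoeff, offCoeffInv]
  rcases lt_trichotomy a b with h | rfl | h
  · simp only [h.ne, h.ne', h, h.not_gt, if_true, if_false]; module
  · simp [smul_smul, hq]
  · simp only [h.ne, h.ne', h, h.not_gt, if_true, if_false]; module

lemma heckeInv_mul_heckeGen (hq : q ≠ 0) (M : Type) [AddCommGroup M] [Module F M] :
    heckeInv F q N M * heckeGen F q N M = 1 := by
  have h := heckeGen_mul_heckeInv (N := N) hq M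
  rwa [heckeGen_eq, add_mul, smul_one_mul, ← mul_smul_one, ← mul_add, ← heckeGen_eq] at h

lemma heckeGen_braid (hq : q ≠ 0) (M : Type) [AddCommGroup M] [Module F M] :
    heckeGen F q N (Fin N → M) * (heckeGen F q N M).compLeft (Fin N) * heckeGen F q N (Fin N → M)
      = (heckeGen F q N M).compLeft (Fin N) * heckeGen F q N (Fin N → M)
        * (heckeGen F q N M).compLeft (Fin N) := by
  refine LinearMap.ext fun f => funext fun a => funext fun b => funext fun c => ?_
  simp only [heckeGen, Module.End.mul_apply, LinearMap.compLeft_apply, Function.comp_apply,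
    braid2_apply, Pi.add_apply, Pi.smul_apply, diagCoeff, offCoeff]
  rcases lt_trichotomy a b with h | h | h <;> rcases lt_trichotomy b c with h' | h' | h' <;>
    rcases lt_trichotomy a c with h'' | h'' | h'' <;> first | omega | skip
  all_goals
    first
    | subst h; subst h'
      simp only [lt_irrefl, if_true, if_false]
    | subst h
      simp only [h'.ne, h'.ne', h', h'.not_gt, lt_irrefl, if_true, if_false]
      match_scalars <;> field_simp <;> ring
    | subst h'
      simp only [h.ne, h.ne', h, h.not_gt, lt_irrefl, if_true, if_false]
      match_scalars <;> field_simp <;> ring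
    | subst h''
      simp only [h.ne, h.ne', h, h.not_gt, lt_irrefl, if_true, if_false]
      match_scalars <;> field_simp <;> ring
    | simp only [h.ne, h.ne', h, h.not_gt, h'.ne, h'.ne', h', h'.not_gt, h''.ne, h''.ne', h'',
        h''.not_gt, if_true, if_false]
      match_scalars <;> field_simp <;> ring

/-- Generators `g₁, g₂, g₃` of a Hecke algebra acting on `V`, with inverses `h₁, h₂, h₃`. -/
structure HeckeAction (F V : Type) [Field F] [AddCommGroup V] [Module F V] (κ : F) where
  (g₁ g₂ g₃ h₁ h₂ h₃ : Module.End F V)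
  hecke₁ : g₁ = h₁ + κ • 1
  hecke₂ : g₂ = h₂ + κ • 1
  hecke₃ : g₃ = h₃ + κ • 1
  inv₁ : h₁ * g₁ = 1
  inv₂ : h₂ * g₂ = 1
  inv₃ : h₃ * g₃ = 1
  braid₁₂ : g₁ * g₂ * g₁ = g₂ * g₁ * g₂
  braid₂₃ : g₂ * g₃ * g₂ = g₃ * g₂ * g₃
  comm₁₃ : h₁ * h₃ = h₃ * h₁

namespace HeckeAction

variable {V : Type} [AddCommGroup V] [Module F V] {κ : F}

/-- The action with the roles of the two outer generators exchanged. -/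
def flip (H : HeckeAction F V κ) : HeckeAction F V κ where
  g₁ := H.g₃
  g₂ := H.g₂
  g₃ := H.g₁
  h₁ := H.h₃
  h₂ := H.h₂
  h₃ := H.h₁
  hecke₁ := H.hecke₃
  hecke₂ := H.hecke₂
  hecke₃ := H.hecke₁
  inv₁ := H.inv₃
  inv₂ := H.inv₂
  inv₃ := H.inv₁
  braid₁₂ := H.braid₂₃.symm
  braid₂₃ := H.braid₁₂.symm
  comm₁₃ := H.comm₁₃.symm

variable (H : HeckeAction F V κ)

lemma g₁_apply (v : V) : H.g₁ v = H.h₁ v + κ • v := by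
  rw [H.hecke₁]; rfl

lemma g₂_apply (v : V) : H.g₂ v = H.h₂ v + κ • v := by
  rw [H.hecke₂]; rfl

lemma g₃_apply (v : V) : H.g₃ v = H.h₃ v + κ • v := H.flip.g₁_apply v

lemma h₁_g₁ (v : V) : H.h₁ (H.g₁ v) = v := LinearMap.congr_fun H.inv₁ v

lemma h₂_g₂ (v : V) : H.h₂ (H.g₂ v) = v := LinearMap.congr_fun H.inv₂ v

lemma h₃_g₃ (v : V) : H.h₃ (H.g₃ v) = v := LinearMap.congr_fun H.inv₃ v

lemma g₁_h₁ (v : V) : H.g₁ (H.h₁ v) = v := by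
  rw [g₁_apply, ← map_smul, ← map_add, ← g₁_apply, h₁_g₁]

lemma g₂_h₂ (v : V) : H.g₂ (H.h₂ v) = v := by
  rw [g₂_apply, ← map_smul, ← map_add, ← g₂_apply, h₂_g₂]

lemma h₁_h₃ (v : V) : H.h₁ (H.h₃ v) = H.h₃ (H.h₁ v) := LinearMap.congr_fun H.comm₁₃ v

lemma g₁_g₂_h₁ (v : V) : H.g₁ (H.g₂ (H.h₁ v)) = H.h₂ (H.g₁ (H.g₂ v)) := by
  have h := LinearMap.congr_fun H.braid₁₂ (H.h₁ v)
  simp only [Module.End.mul_apply, g₁_h₁] at h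
  rw [h, h₂_g₂]

lemma g₁_h₂_h₁ (v : V) : H.g₁ (H.h₂ (H.h₁ v)) = H.h₂ (H.h₁ (H.g₂ v)) := by
  have h := LinearMap.congr_fun H.braid₁₂ (H.h₂ (H.h₁ v))
  simp only [Module.End.mul_apply, g₁_h₁, g₂_h₂] at h
  rw [← h, h₁_g₁, h₂_g₂]

lemma g₃_g₂_h₃ (v : V) : H.g₃ (H.g₂ (H.h₃ v)) = H.h₂ (H.g₃ (H.g₂ v)) := H.flip.g₁_g₂_h₁ v

lemma g₃_h₂_h₃ (v : V) : H.g₃ (H.h₂ (H.h₃ v)) = H.h₂ (H.h₃ (H.g₂ v)) := H.flip.g₁_h₂_h₁ v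

/-- The coefficients `S⁽ʳ⁾ ⊗ S⁽ˢ⁾` of the Baxterized tensor square: `Ω`, `g₁⁻¹ Ω`, `g₃⁻¹ Ω` and
`g₁⁻¹ g₃⁻¹ Ω`, extended by zero. -/
def coeff (Ω : V) (r s : ℤ) : V :=
  if r = 0 then (if s = 0 then Ω else if s = 1 then H.h₃ Ω else 0)
  else if r = 1 then
    (if s = 0 then H.h₁ Ω else if s = 1 then H.h₁ (H.h₃ Ω) else 0)
  else 0

/-- A solution of the constant reflection equation Baxterizes to a solution of the affine one. -/
theorem affine_of_constant {Ω : V} (hΩ : H.g₁ (H.g₂ Ω) = H.g₃ (H.g₂ Ω)) (a b : ℤ) :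
    H.h₁ (H.h₂ (H.coeff Ω (-a) (-b))) - H.h₁ (H.g₂ (H.coeff Ω (1 - a) (1 - b)))
        - H.g₁ (H.h₂ (H.coeff Ω (-1 - a) (1 - b))) + H.g₁ (H.g₂ (H.coeff Ω (-a) (2 - b)))
      = H.h₃ (H.h₂ (H.coeff Ω (-b) (-a))) - H.g₃ (H.h₂ (H.coeff Ω (1 - b) (-1 - a)))
        - H.h₃ (H.g₂ (H.coeff Ω (1 - b) (1 - a))) + H.g₃ (H.g₂ (H.coeff Ω (2 - b) (-a))) := by
  have e₁ : H.h₁ (H.g₂ Ω) = H.h₃ (H.g₂ Ω) := by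
    rwa [g₁_apply, g₃_apply, add_left_inj] at hΩ
  have e₂ : H.g₁ (H.g₂ (H.h₁ Ω)) = H.g₃ (H.g₂ (H.h₃ Ω)) := by
    rw [g₁_g₂_h₁, g₃_g₂_h₃, hΩ]
  have e₃ : H.h₁ (H.g₂ (H.h₃ Ω)) = H.h₃ (H.g₂ (H.h₁ Ω)) := by
    have h := congrArg (fun v => H.h₁ (H.h₃ v)) e₂
    rwa [h₃_g₃, h₁_h₃, h₁_g₁, eq_comm] at h
  have e₄ : H.g₁ (H.h₂ (H.h₁ Ω)) = H.g₃ (H.h₂ (H.h₃ Ω)) := by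
    rw [g₁_h₂_h₁, g₃_h₂_h₃, e₁]
  have e₅ : H.h₁ (H.h₂ (H.h₃ Ω)) = H.h₃ (H.h₂ (H.h₁ Ω)) := by
    have h := congrArg (fun v => H.h₁ (H.h₃ v)) e₄
    rwa [h₃_g₃, h₁_h₃, h₁_g₁, eq_comm] at h
  have e₆ : H.g₁ (H.h₂ (H.h₁ (H.h₃ Ω))) = H.g₃ (H.h₂ (H.h₁ (H.h₃ Ω))) := by
    rw [g₁_h₂_h₁, e₃, h₁_h₃, g₃_h₂_h₃]
  have e₇ : H.g₁ (H.g₂ (H.h₁ (H.h₃ Ω))) - H.g₃ (H.g₂ (H.h₁ (H.h₃ Ω)))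
      = κ • H.h₃ Ω - κ • H.h₁ Ω := by
    rw [g₁_g₂_h₁, h₁_h₃, g₃_g₂_h₃, g₁_apply, g₃_apply, e₃]
    simp only [map_add, map_smul, h₂_g₂]
    module
  have e₈ : H.h₁ (H.h₂ Ω) - H.h₃ (H.h₂ Ω) = κ • H.h₃ Ω - κ • H.h₁ Ω := by
    rw [g₂_apply, map_add, map_add, map_smul, map_smul] at e₁
    linear_combination (norm := module) e₁
  rw [g₁_apply, g₃_apply] at e₂ e₄ e₆ e₇
  by_cases ha : a < -2 ∨ 1 < a
  · have h₀ : -a ≠ 0 ∧ -a ≠ 1 ∧ 1 - a ≠ 0 ∧ 1 - a ≠ 1 ∧ -1 - a ≠ 0 ∧ -1 - a ≠ 1 := by omega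
    simp [coeff, h₀]
  by_cases hb : b < -1 ∨ 2 < b
  · have h₀ : -b ≠ 0 ∧ -b ≠ 1 ∧ 1 - b ≠ 0 ∧ 1 - b ≠ 1 ∧ 2 - b ≠ 0 ∧ 2 - b ≠ 1 := by omega
    simp [coeff, h₀]
  have ha₁ : -2 ≤ a := by omega
  have ha₂ : a ≤ 1 := by omega
  have hb₁ : -1 ≤ b := by omega
  have hb₂ : b ≤ 2 := by omega
  rw [g₁_apply, g₁_apply, g₃_apply, g₃_apply]
  interval_cases a <;> interval_cases b <;> norm_num [coeff]
  · linear_combination (norm := module) e₆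
  · linear_combination (norm := module) -e₄
  · linear_combination (norm := module) e₆
  · linear_combination (norm := module) e₄ - e₅
  · linear_combination (norm := module) e₇ - e₈
  · linear_combination (norm := module) e₂
  · linear_combination (norm := module) e₅
  · linear_combination (norm := module) e₈ - e₇
  · linear_combination (norm := module) e₃ - e₂
  · exact e₁
  · exact e₃
  · exact e₁

end HeckeAction

variable {A : Type} [Ring A] [Algebra F A]

/-- The Hecke action on four-index tensors given by the braiding `P R`. -/
def heckeAction (N : ℕ) (A : Type) [Ring A] [Algebra F A] (hq : q ≠ 0) :
    HeckeAction F (Tensor4 N A) (q - q⁻¹) where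
  g₁ := braidFst (diagCoeff F q N) (offCoeff F q N)
  g₂ := braidMid (diagCoeff F q N) (offCoeff F q N)
  g₃ := braidLst (diagCoeff F q N) (offCoeff F q N)
  h₁ := braidFst (diagCoeff F q⁻¹ N) (offCoeffInv F q N)
  h₂ := braidMid (diagCoeff F q⁻¹ N) (offCoeffInv F q N)
  h₃ := braidLst (diagCoeff F q⁻¹ N) (offCoeffInv F q N)
  hecke₁ := heckeGen_eq _
  hecke₂ := LinearMap.ext fun f => funext fun a => LinearMap.congr_fun (heckeGen_eq _) (f a)
  hecke₃ := LinearMap.ext fun f => funext fun a => funext fun b =>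
    LinearMap.congr_fun (heckeGen_eq _) (f a b)
  inv₁ := heckeInv_mul_heckeGen hq _
  inv₂ := LinearMap.ext fun f => funext fun a =>
    LinearMap.congr_fun (heckeInv_mul_heckeGen hq _) (f a)
  inv₃ := LinearMap.ext fun f => funext fun a => funext fun b =>
    LinearMap.congr_fun (heckeInv_mul_heckeGen hq _) (f a b)
  braid₁₂ := heckeGen_braid hq _
  braid₂₃ := LinearMap.ext fun f => funext fun a =>
    LinearMap.congr_fun (heckeGen_braid hq _) (f a)
  comm₁₃ := by
    refine LinearMap.ext fun f => funext fun a => funext fun b => funext fun c => funext fun d => ?_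
    simp only [Module.End.mul_apply, braidFst_apply, braidLst_apply]
    module

end Hecke

section Evaluation

variable {F : Type} [Field F] {q : F} {N : ℕ} {A B : Type} [Ring A] [Algebra F A] [Ring B]
  [Algebra F B]

/-- A sequence of matrices extended by zero to negative indices. -/
def extendZero (X : ℕ → Matrix (Fin N) (Fin N) A) (r : ℤ) : Matrix (Fin N) (Fin N) A :=
  if 0 ≤ r then X r.toNat else 0

lemma z1_eq_amp1 (X : ℕ → Matrix (Fin N) (Fin N) A) (r : ℤ) : z1 X r = amp1 (extendZero X r) := by
  unfold z1 extendZero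
  split_ifs
  · rfl
  · ext; simp [amp1]

lemma z2_eq_amp2 (X : ℕ → Matrix (Fin N) (Fin N) A) (r : ℤ) : z2 X r = amp2 (extendZero X r) := by
  unfold z2 extendZero
  split_ifs
  · rfl
  · ext; simp [amp2]

lemma extendZero_map (f : A →ₐ[F] B) (X : ℕ → Matrix (Fin N) (Fin N) A) (r : ℤ) :
    extendZero (fun n => (X n).map f) r = (extendZero X r).map f := by
  unfold extendZero
  split_ifs
  · rfl
  · ext; simp

lemma map_reflection_left (f : A →ₐ[F] B) (α β α' β' : Fin N → Fin N → F)
    (S T : Matrix (Fin N) (Fin N) A) (p r : Fin N × Fin N) :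
    f ((liftF F (permMat α β) * amp1 S * liftF F (permMatT α' β') * amp2 T :
          Matrix (Fin N × Fin N) (Fin N × Fin N) A) p r)
      = (liftF F (permMat α β) * amp1 (S.map f) * liftF F (permMatT α' β') * amp2 (T.map f) :
          Matrix (Fin N × Fin N) (Fin N × Fin N) B) p r := by
  obtain ⟨i, j⟩ := p
  obtain ⟨k, l⟩ := r
  rw [reflection_left_apply, reflection_left_apply]
  simp [braidFst_apply, braidMid_apply, tensorMul]

lemma map_reflection_right (f : A →ₐ[F] B) (α β α' β' : Fin N → Fin N → F)
    (hα : ∀ a b, α a b = α b a) (hα' : ∀ a b, α' a b = α' b a)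
    (S T : Matrix (Fin N) (Fin N) A) (p r : Fin N × Fin N) :
    f ((amp2 T * liftF F (permMatT α' β') * amp1 S * liftF F (permMat α β) :
          Matrix (Fin N × Fin N) (Fin N × Fin N) A) p r)
      = (amp2 (T.map f) * liftF F (permMatT α' β') * amp1 (S.map f) * liftF F (permMat α β) :
          Matrix (Fin N × Fin N) (Fin N × Fin N) B) p r := by
  obtain ⟨i, j⟩ := p
  obtain ⟨k, l⟩ := r
  rw [reflection_right_apply _ _ _ _ hα hα', reflection_right_apply _ _ _ _ hα hα']
  simp [braidLst_apply, braidMid_apply, tensorMul]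

lemma map_reflLHS (f : A →ₐ[F] B) (S : Matrix (Fin N) (Fin N) A) (p r : Fin N × Fin N) :
    f (reflLHS F q S p r) = reflLHS F q (S.map f) p r := by
  simp only [reflLHS, Rc_eq_permMat, Rct_eq_permMatT, map_reflection_left]

lemma map_reflRHS (f : A →ₐ[F] B) (S : Matrix (Fin N) (Fin N) A) (p r : Fin N × Fin N) :
    f (reflRHS F q S p r) = reflRHS F q (S.map f) p r := by
  simp only [reflRHS, Rc_eq_permMat, Rct_eq_permMatT,
    map_reflection_right f _ _ _ _ (diagCoeff_comm F q) (diagCoeff_comm F q)]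

lemma map_affLHS (f : A →ₐ[F] B) (X : ℕ → Matrix (Fin N) (Fin N) A) (a b : ℤ)
    (p r : Fin N × Fin N) :
    f (affLHS F q X a b p r) = affLHS F q (fun n => (X n).map f) a b p r := by
  simp only [affLHS, Rc_eq_permMat, Rct_eq_permMatT, Rtil_eq_permMat, Rtilt_eq_permMatT,
    z1_eq_amp1, z2_eq_amp2, extendZero_map, Matrix.add_apply, Matrix.sub_apply, map_add, map_sub,
    map_reflection_left]

lemma map_affRHS (f : A →ₐ[F] B) (X : ℕ → Matrix (Fin N) (Fin N) A) (a b : ℤ)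
    (p r : Fin N × Fin N) :
    f (affRHS F q X a b p r) = affRHS F q (fun n => (X n).map f) a b p r := by
  simp only [affRHS, Rc_eq_permMat, Rct_eq_permMatT, Rtil_eq_permMat, Rtilt_eq_permMatT,
    z1_eq_amp1, z2_eq_amp2, extendZero_map, Matrix.add_apply, Matrix.sub_apply, map_add, map_sub,
    map_reflection_right f _ _ _ _ (diagCoeff_comm F q) (diagCoeff_comm F q),
    map_reflection_right f _ _ _ _ (diagCoeff_comm F q) (diagCoeff_comm F q⁻¹),
    map_reflection_right f _ _ _ _ (diagCoeff_comm F q⁻¹) (diagCoeff_comm F q),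
    map_reflection_right f _ _ _ _ (diagCoeff_comm F q⁻¹) (diagCoeff_comm F q⁻¹)]

lemma affLHS_zero_two (X : ℕ → Matrix (Fin N) (Fin N) A) :
    affLHS F q X 0 2 = reflLHS F q (X 0) := by
  simp [affLHS, reflLHS, z1, z2]

lemma affRHS_zero_two (X : ℕ → Matrix (Fin N) (Fin N) A) :
    affRHS F q X 0 2 = reflRHS F q (X 0) := by
  simp [affRHS, reflRHS, z1, z2]

/-- The matrix `(P R)⁻¹ S`. -/
def heckeInvMat (F : Type) [Field F] (q : F) {N : ℕ} {A : Type} [Ring A] [Algebra F A]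
    (S : Matrix (Fin N) (Fin N) A) : Matrix (Fin N) (Fin N) A :=
  Matrix.of fun i j => diagCoeff F q⁻¹ N j i • S j i + offCoeffInv F q N j i • S i j

/-- The coefficients of `S + u⁻¹ (P R)⁻¹ S`. -/
def evalCoeff (F : Type) [Field F] (q : F) {N : ℕ} {A : Type} [Ring A] [Algebra F A]
    (S : Matrix (Fin N) (Fin N) A) (r : ℕ) : Matrix (Fin N) (Fin N) A :=
  if r = 0 then S else if r = 1 then heckeInvMat F q S else 0

lemma extendZero_evalCoeff (S : Matrix (Fin N) (Fin N) A) (r : ℤ) :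
    extendZero (evalCoeff F q S) r
      = if r = 0 then S else if r = 1 then heckeInvMat F q S else 0 := by
  unfold extendZero evalCoeff
  by_cases hr : 0 ≤ r
  · lift r to ℕ using hr
    simp
  · rw [if_neg hr, if_neg (by omega), if_neg (by omega)]

lemma tensorMul_extendZero (hq : q ≠ 0) (S : Matrix (Fin N) (Fin N) A) (r s : ℤ) :
    tensorMul (extendZero (evalCoeff F q S) r) (extendZero (evalCoeff F q S) s)
      = (heckeAction N A hq).coeff (tensorMul S S) r s := by
  have h₁ (T : Matrix (Fin N) (Fin N) A) : tensorMul (heckeInvMat F q S) T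
      = (heckeAction N A hq).h₁ (tensorMul S T) := by
    refine funext fun a => funext fun b => funext fun c => funext fun d => ?_
    change (diagCoeff F q⁻¹ N b a • S b a + offCoeffInv F q N b a • S a b) * T c d
      = diagCoeff F q⁻¹ N b a • (S b a * T c d) + offCoeffInv F q N b a • (S a b * T c d)
    rw [add_mul, smul_mul_assoc, smul_mul_assoc]
  have h₃ (T : Matrix (Fin N) (Fin N) A) : tensorMul T (heckeInvMat F q S)
      = (heckeAction N A hq).h₃ (tensorMul T S) := by
    refine funext fun a => funext fun b => funext fun c => funext fun d => ?_
    change T a b * (diagCoeff F q⁻¹ N d c • S d c + offCoeffInv F q N d c • S c d)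
      = diagCoeff F q⁻¹ N d c • (T a b * S d c) + offCoeffInv F q N d c • (T a b * S c d)
    rw [mul_add, mul_smul_comm, mul_smul_comm]
  have h₀ (T : Matrix (Fin N) (Fin N) A) : tensorMul 0 T = 0 := by
    refine funext fun a => funext fun b => funext fun c => funext fun d => ?_
    simp [tensorMul]
  have hz (T : Matrix (Fin N) (Fin N) A) : tensorMul T 0 = 0 := by
    refine funext fun a => funext fun b => funext fun c => funext fun d => ?_
    simp [tensorMul]
  rw [extendZero_evalCoeff, extendZero_evalCoeff, HeckeAction.coeff]
  split_ifs <;> simp only [h₀, hz, h₁, h₃]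

/-- If `S` satisfies the reflection equation, then `S + u⁻¹ (P R)⁻¹ S` satisfies the affine
reflection equation. -/
theorem affine_reflection_evalCoeff (hq : q ≠ 0) {S : Matrix (Fin N) (Fin N) A}
    (hS : reflLHS F q S = reflRHS F q S) (a b : ℤ) :
    affLHS F q (evalCoeff F q S) a b = affRHS F q (evalCoeff F q S) a b := by
  have hΩ : (heckeAction N A hq).g₁ ((heckeAction N A hq).g₂ (tensorMul S S))
      = (heckeAction N A hq).g₃ ((heckeAction N A hq).g₂ (tensorMul S S)) := by
    refine funext fun j => funext fun i => funext fun k => funext fun l => ?_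
    have h := congrFun (congrFun hS (i, j)) (k, l)
    rw [reflLHS, reflRHS, Rc_eq_permMat, Rct_eq_permMatT, reflection_left_apply,
      reflection_right_apply _ _ _ _ (diagCoeff_comm F q) (diagCoeff_comm F q)] at h
    exact h
  ext ⟨i, j⟩ ⟨k, l⟩
  have h := congrFun (congrFun (congrFun (congrFun
    ((heckeAction N A hq).affine_of_constant hΩ a b) j) i) k) l
  simp only [affLHS, affRHS, Rc_eq_permMat, Rct_eq_permMatT, Rtil_eq_permMat, Rtilt_eq_permMatT,
    z1_eq_amp1, z2_eq_amp2, Matrix.add_apply, Matrix.sub_apply, reflection_left_apply,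
    reflection_right_apply _ _ _ _ (diagCoeff_comm F q) (diagCoeff_comm F q),
    reflection_right_apply _ _ _ _ (diagCoeff_comm F q) (diagCoeff_comm F q⁻¹),
    reflection_right_apply _ _ _ _ (diagCoeff_comm F q⁻¹) (diagCoeff_comm F q),
    reflection_right_apply _ _ _ _ (diagCoeff_comm F q⁻¹) (diagCoeff_comm F q⁻¹),
    tensorMul_extendZero hq]
  exact h

end Evaluation

section Embedding

variable (F : Type) [Field F] (q : F) (N : ℕ)

lemma reflection_sOS :
    reflLHS F q (Matrix.of (sOS F q N)) = reflRHS F q (Matrix.of (sOS F q N)) := by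
  ext p r
  have h := RingQuot.mkAlgHom_rel F (OSRel.refl (F := F) (q := q) p r)
  rwa [map_reflLHS, map_reflRHS] at h

lemma reflection_sAO_zero :
    reflLHS F q (Matrix.of (sAO F q N 0)) = reflRHS F q (Matrix.of (sAO F q N 0)) := by
  ext p r
  have h := RingQuot.mkAlgHom_rel F (AORel.refl (F := F) (q := q) 0 2 p r)
  rwa [map_affLHS, map_affRHS, affLHS_zero_two, affRHS_zero_two] at h

/-- The homomorphism `s_ij ↦ s_ij^{(0)}`. -/
def finiteToAffine : AlgOS F q N →ₐ[F] AlgAO F q N :=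
  RingQuot.liftAlgHom F ⟨FreeAlgebra.lift F fun x => sAO F q N 0 x.1 x.2, by
    intro x y h
    induction h with
    | tri i j hij =>
      rw [FreeAlgebra.lift_ι_apply, map_zero, sAO, RingQuot.mkAlgHom_rel F (AORel.tri i j hij),
        map_zero]
    | diag i =>
      rw [FreeAlgebra.lift_ι_apply, map_one, sAO, RingQuot.mkAlgHom_rel F (AORel.diag i), map_one]
    | refl p r =>
      have hS : (Sfree F N).map (FreeAlgebra.lift F fun x => sAO F q N 0 x.1 x.2)
          = Matrix.of (sAO F q N 0) := by
        ext i j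
        simp [Sfree]
      rw [map_reflLHS, map_reflRHS, hS, reflection_sAO_zero]⟩

lemma finiteToAffine_sOS (i j : Fin N) :
    finiteToAffine F q N (sOS F q N i j) = sAO F q N 0 i j := by
  rw [finiteToAffine, sOS, RingQuot.liftAlgHom_mkAlgHom_apply, FreeAlgebra.lift_ι_apply]

variable {q}

/-- The evaluation homomorphism `S(u) ↦ S + u⁻¹ (P R)⁻¹ S`. -/
def affineToFinite (hq : q ≠ 0) : AlgAO F q N →ₐ[F] AlgOS F q N :=
  RingQuot.liftAlgHom F ⟨FreeAlgebra.lift F fun x =>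
      evalCoeff F q (Matrix.of (sOS F q N)) x.1 x.2.1 x.2.2, by
    intro x y h
    induction h with
    | tri i j hij =>
      rw [FreeAlgebra.lift_ι_apply, map_zero]
      exact (RingQuot.mkAlgHom_rel F (OSRel.tri i j hij)).trans (map_zero _)
    | diag i =>
      rw [FreeAlgebra.lift_ι_apply, map_one]
      exact (RingQuot.mkAlgHom_rel F (OSRel.diag i)).trans (map_one _)
    | refl a b p r =>
      have hS : (fun n => (SfreeA F N n).map (FreeAlgebra.lift F fun x =>
          evalCoeff F q (Matrix.of (sOS F q N)) x.1 x.2.1 x.2.2))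
          = evalCoeff F q (Matrix.of (sOS F q N)) := by
        ext n i j
        simp [SfreeA]
      rw [map_affLHS, map_affRHS, hS, affine_reflection_evalCoeff hq (reflection_sOS F q N)]⟩

lemma affineToFinite_sAO_zero (hq : q ≠ 0) (i j : Fin N) :
    affineToFinite F N hq (sAO F q N 0 i j) = sOS F q N i j := by
  rw [affineToFinite, sAO, RingQuot.liftAlgHom_mkAlgHom_apply, FreeAlgebra.lift_ι_apply]
  rfl

lemma finiteToAffine_injective (hq : q ≠ 0) : Function.Injective (finiteToAffine F q N) := by
  have h : (affineToFinite F N hq).comp (finiteToAffine F q N) = AlgHom.id F _ := by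
    refine RingQuot.ringQuot_ext' F _ _ (FreeAlgebra.hom_ext (funext fun x => ?_))
    exact (congrArg _ (finiteToAffine_sOS F q N x.1 x.2)).trans
      (affineToFinite_sAO_zero F N hq x.1 x.2)
  exact Function.LeftInverse.injective (g := affineToFinite F N hq) fun x => AlgHom.congr_fun h x

end Embedding

/-- The map `s_ij ↦ s_ij^{(0)}` defines an embedding of the twisted
quantized enveloping algebra `U^tw_q(o_N)` into the twisted q-Yangian `Y^tw_q(o_N)`
(both taken in their presentations). -/
theorem stmt13 (N : ℕ) :
    ∃ φ : AlgOS FF qq N →ₐ[FF] AlgAO FF qq N,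
      Function.Injective φ ∧
        ∀ i j : Fin N, φ (sOS FF qq N i j) = sAO FF qq N 0 i j := by
  exact ⟨finiteToAffine FF qq N, finiteToAffine_injective FF N RatFunc.X_ne_zero,
    finiteToAffine_sOS FF qq N⟩
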